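/- arXiv:2211.05038 — 3 statements merged into one kernel-verified Lean document; each statement's English description precedes it below -/
import Mathlib

section
/- For all natural numbers w ≥ 1, n ≥ 1 and p ≥ 1, the w-th cycle power of Finsupp.single p n equals Finsupp.single p (p^(w−1) * n^w). In the dynamical interpretation: (C^n_p)^{⊙w} = C^{p^{w−1}n^w}_p. -/
/-- The cycle product of two unions of disjoint cycles: `(f ⊙ g) r` equals
`∑_{p ∈ f.support} ∑_{q ∈ g.support, lcm p q = r} f p * g q * (p * q / lcm p q)`. -/
noncomputable def cycProd (f g : ℕ →₀ ℕ) : ℕ →₀ ℕ :=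
  ∑ p ∈ f.support, ∑ q ∈ g.support,
    Finsupp.single (Nat.lcm p q) (f p * g q * (p * q / Nat.lcm p q))

/-- Iterated cycle power: `f^{⊙0} = C¹₁` and `f^{⊙(k+1)} = f ⊙ f^{⊙k}`. -/
noncomputable def cycPow (f : ℕ →₀ ℕ) : ℕ → ℕ →₀ ℕ
  | 0 => Finsupp.single 1 1
  | k + 1 => cycProd f (cycPow f k)

theorem cycProd_single_single (p q m n : ℕ) :
    cycProd (Finsupp.single p m) (Finsupp.single q n) =
      Finsupp.single (Nat.lcm p q) (m * n * (p * q / Nat.lcm p q)) := by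
  rcases eq_or_ne m 0 with rfl | hm
  · simp [cycProd]
  rcases eq_or_ne n 0 with rfl | hn
  · simp [cycProd]
  simp [cycProd, Finsupp.support_single p hm, Finsupp.support_single q hn]

theorem cycPow_single_succ (k n : ℕ) {p : ℕ} (hp : 0 < p) :
    cycPow (Finsupp.single p n) (k + 1) = Finsupp.single p (p ^ k * n ^ (k + 1)) := by
  induction k with
  | zero => simp [cycPow, cycProd_single_single, Nat.div_self hp]
  | succ k ih =>
    rw [cycPow, ih, cycProd_single_single, Nat.lcm_self, Nat.mul_div_cancel _ hp]
    congr 1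
    ring

theorem stmt_6 (w n p : ℕ) (hw : 1 ≤ w) (hn : 1 ≤ n) (hp : 1 ≤ p) :
    cycPow (Finsupp.single p n) w = Finsupp.single p (p ^ (w - 1) * n ^ w) := by
  obtain ⟨k, rfl⟩ := Nat.exists_eq_add_of_le' hw
  exact cycPow_single_succ k n hp
end

section
/- Let w ≥ 2 and let x, b : ℕ →₀ ℕ have supports containing only positive integers, with x^{⊙w} = b. Write x.support = {p₁ < p₂ < … < p_l} and fix i with 2 ≤ i < l. Let y : ℕ →₀ ℕ be the restriction of x to {p₁, …, p_i} (y agrees with x there and is 0 elsewhere). Then p_{i+1} is the least element of the set { o ∈ b.support : o > p_i and (y^{⊙w}) o < b o } (equivalently, in the paper's formulation with y^{⊙w} = C^{s'_1}_{o'_1} ⊕ … ⊕ C^{s'_t}_{o'_t}, p_{i+1} = o_ξ where ξ is the least index j with o_j > p_i and either o_j > o'_t or o_j = o'_z for some z with s'_z < s_j). -/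
/-- `pElt x j` is the `(j+1)`-st smallest element of the support of `x`
(so `pElt x 0 = p₁`, `pElt x 1 = p₂`, …, in the notation `x.support = {p₁ < p₂ < … < p_l}`). -/
noncomputable def pElt (x : ℕ →₀ ℕ) (j : ℕ) : ℕ := (x.support.sort (· ≤ ·)).getD j 0

theorem cycProd_apply (f g : ℕ →₀ ℕ) {o : ℕ} (ho : o ≠ 0) :
    cycProd f g o = ∑ p ∈ o.divisors, ∑ q ∈ o.divisors,
      if Nat.lcm p q = o then f p * g q * (p * q / o) else 0 := by
  have h : cycProd f g o = ∑ p ∈ f.support, ∑ q ∈ g.support,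
      if Nat.lcm p q = o then f p * g q * (p * q / o) else 0 := by
    simp only [cycProd, Finsupp.finsetSum_apply, Finsupp.single_apply]
    refine Finset.sum_congr rfl fun p _ => Finset.sum_congr rfl fun q _ => ?_
    split_ifs with hpq
    · rw [hpq]
    · rfl
  rw [h, ← Finset.sum_product', ← Finset.sum_product']
  refine Finset.sum_congr_of_eq_on_inter ?_ ?_ fun _ _ _ => rfl
  · rintro ⟨p, q⟩ - hpq
    refine if_neg fun hl => hpq ?_
    dsimp only at hl
    simp only [Finset.mem_product, Nat.mem_divisors]
    exact ⟨⟨hl ▸ Nat.dvd_lcm_left p q, ho⟩, ⟨hl ▸ Nat.dvd_lcm_right p q, ho⟩⟩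
  · rintro ⟨p, q⟩ - hpq
    simp only [Finset.mem_product, Finsupp.mem_support_iff, not_and_or, not_not] at hpq
    rcases hpq with hpq | hpq <;> simp [hpq]

theorem cycProd_apply_le {f f' g g' : ℕ →₀ ℕ} {o : ℕ} (ho : o ≠ 0)
    (hf : ∀ p, p ∣ o → f p ≤ f' p) (hg : ∀ q, q ∣ o → g q ≤ g' q) :
    cycProd f g o ≤ cycProd f' g' o := by
  rw [cycProd_apply f g ho, cycProd_apply f' g' ho]
  refine Finset.sum_le_sum fun p hp => Finset.sum_le_sum fun q hq => ?_
  have := hf p (Nat.dvd_of_mem_divisors hp)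
  have := hg q (Nat.dvd_of_mem_divisors hq)
  split_ifs
  · gcongr
  · rfl

theorem cycProd_apply_lt {f f' g g' : ℕ →₀ ℕ} {o d : ℕ} (ho : o ≠ 0)
    (hf : ∀ p, p ∣ o → f p ≤ f' p) (hg : ∀ q, q ∣ o → g q ≤ g' q)
    (hlt : f o < f' o) (hd : d ∣ o) (hpos : 0 < g' d) :
    cycProd f g o < cycProd f' g' o := by
  rw [cycProd_apply f g ho, cycProd_apply f' g' ho, ← Finset.sum_product',
    ← Finset.sum_product']
  refine Finset.sum_lt_sum ?_ ⟨(o, d), ?_, ?_⟩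
  · rintro ⟨p, q⟩ h
    simp only [Finset.mem_product, Nat.mem_divisors] at h
    have := hf p h.1.1
    have := hg q h.2.1
    dsimp only
    split_ifs
    · gcongr
    · rfl
  · simp [ho, hd]
  · have hl : Nat.lcm o d = o := Nat.lcm_eq_left hd
    have ho' := Nat.pos_of_ne_zero ho
    simp only [hl, if_true, Nat.mul_div_cancel_left d ho']
    refine Nat.mul_lt_mul_of_pos_right ?_ (Nat.pos_of_dvd_of_pos hd ho')
    exact Nat.mul_lt_mul_of_lt_of_le hlt (hg d hd) hpos

theorem cycPow_apply_le {f f' : ℕ →₀ ℕ} (hf : f ≤ f') (k : ℕ) {o : ℕ} (ho : o ≠ 0) :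
    cycPow f k o ≤ cycPow f' k o := by
  induction k generalizing o with
  | zero => rfl
  | succ k ih =>
    exact cycProd_apply_le ho (fun p _ => hf p) fun q hq => ih (ne_zero_of_dvd_ne_zero ho hq)

theorem cycPow_apply_congr {f f' : ℕ →₀ ℕ} {o : ℕ} (ho : o ≠ 0)
    (h : ∀ p, p ∣ o → f p = f' p) (k : ℕ) : cycPow f k o = cycPow f' k o := by
  induction k generalizing o with
  | zero => rfl
  | succ k ih =>
    have hq : ∀ q, q ∣ o → cycPow f k q = cycPow f' k q := fun q hq =>
      ih (ne_zero_of_dvd_ne_zero ho hq) fun p hp => h p (hp.trans hq)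
    exact le_antisymm
      (cycProd_apply_le ho (fun p hp => (h p hp).le) fun q hqo => (hq q hqo).le)
      (cycProd_apply_le ho (fun p hp => (h p hp).ge) fun q hqo => (hq q hqo).ge)

theorem cycPow_succ_apply_lt {f f' : ℕ →₀ ℕ} (hf : f ≤ f') {o : ℕ} (ho : o ≠ 0)
    (hlt : f o < f' o) (k : ℕ) : cycPow f (k + 1) o < cycPow f' (k + 1) o := by
  have key : ∀ k {d}, d ∣ o → 0 < cycPow f' k d → cycPow f (k + 1) o < cycPow f' (k + 1) o :=
    fun k _ hd hpos => cycProd_apply_lt ho (fun p _ => hf p)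
      (fun q hq => cycPow_apply_le hf k (ne_zero_of_dvd_ne_zero ho hq)) hlt hd hpos
  induction k with
  | zero => exact key 0 (one_dvd o) (by simp [cycPow])
  | succ k ih => exact key (k + 1) dvd_rfl (Nat.zero_lt_of_lt ih)

theorem pElt_mem {x : ℕ →₀ ℕ} {j : ℕ} (hj : j < x.support.card) : pElt x j ∈ x.support := by
  have hj' : j < (x.support.sort (· ≤ ·)).length := by simpa using hj
  rw [pElt, List.getD_eq_getElem _ _ hj', ← Finset.mem_sort (· ≤ ·)]
  exact List.getElem_mem hj'

theorem pElt_lt_pElt {x : ℕ →₀ ℕ} {j k : ℕ} (hjk : j < k) (hk : k < x.support.card) :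
    pElt x j < pElt x k := by
  have hk' : k < (x.support.sort (· ≤ ·)).length := by simpa using hk
  rw [pElt, pElt, List.getD_eq_getElem _ _ hk', List.getD_eq_getElem _ _ (hjk.trans hk')]
  exact (Finset.sortedLT_sort x.support).strictMono_get (a := ⟨j, hjk.trans hk'⟩)
    (b := ⟨k, hk'⟩) hjk

theorem exists_pElt_eq {x : ℕ →₀ ℕ} {p : ℕ} (hp : p ∈ x.support) :
    ∃ j < x.support.card, pElt x j = p := by
  obtain ⟨j, hj, rfl⟩ := List.getElem_of_mem ((Finset.mem_sort (· ≤ ·)).2 hp)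
  exact ⟨j, by simpa using hj, List.getD_eq_getElem _ _ hj⟩

theorem pElt_succ_le {x : ℕ →₀ ℕ} {j p : ℕ} (hp : p ∈ x.support) (hjp : pElt x j < p)
    (hj : j < x.support.card) : pElt x (j + 1) ≤ p := by
  obtain ⟨k, hk, rfl⟩ := exists_pElt_eq hp
  have hjk : j < k := by
    by_contra! h
    rcases h.lt_or_eq with h | rfl
    · exact lt_asymm hjp (pElt_lt_pElt h hj)
    · exact lt_irrefl _ hjp
  rcases (Nat.succ_le_of_lt hjk).lt_or_eq with h | rfl
  · exact (pElt_lt_pElt h hk).le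
  · rfl

theorem stmt_14 (w : ℕ) (hw : 2 ≤ w) (x b : ℕ →₀ ℕ)
    (hx : ∀ p ∈ x.support, 0 < p) (hb : ∀ p ∈ b.support, 0 < p)
    (heq : cycPow x w = b)
    -- `i` is the paper's index: `2 ≤ i < l`; with the `0`-based `pElt`,
    -- `p_i = pElt x (i-1)` and `p_{i+1} = pElt x i`.
    (i : ℕ) (hi2 : 2 ≤ i) (hil : i < x.support.card) :
    pElt x i =
      sInf {o : ℕ | o ∈ b.support ∧ pElt x (i - 1) < o ∧
        (cycPow (x.filter (fun a => a ≤ pElt x (i - 1))) w) o < b o} := by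
  obtain ⟨j, rfl⟩ : ∃ j, i = j + 1 := ⟨i - 1, by omega⟩
  obtain ⟨k, rfl⟩ : ∃ k, w = k + 1 := ⟨w - 1, by omega⟩
  subst heq
  simp only [Nat.add_sub_cancel]
  set y := x.filter (fun a => a ≤ pElt x j)
  have hyx : y ≤ x := fun p => by
    simp only [y, Finsupp.filter_apply]
    split_ifs <;> simp
  have hmem := pElt_mem hil
  have hlt : pElt x j < pElt x (j + 1) := pElt_lt_pElt j.lt_succ_self hil
  have hpow := cycPow_succ_apply_lt (o := pElt x (j + 1)) hyx (hx _ hmem).ne' (by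
    simpa [y, Finsupp.filter_apply, hlt.not_ge, pos_iff_ne_zero] using hmem) k
  refine (IsLeast.csInf_eq ⟨?_, ?_⟩).symm
  · exact ⟨Finsupp.mem_support_iff.2 (Nat.ne_zero_of_lt hpow), hlt, hpow⟩
  · rintro o ⟨hob, -, ho⟩
    by_contra! hoj
    have ho0 := hb o hob
    refine ho.ne (cycPow_apply_congr ho0.ne' (fun p hp => ?_) _)
    simp only [y, Finsupp.filter_apply]
    split_ifs with h
    · rfl
    · by_contra hne
      exact absurd (pElt_succ_le (Finsupp.mem_support_iff.2 (Ne.symm hne)) (not_le.1 h) (by omega))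
        (((Nat.le_of_dvd ho0 hp).trans_lt hoj).not_ge)
end

section
/- w-th roots of unions of cycles are unique: for every natural number w ≥ 2, if x, y : ℕ →₀ ℕ have supports containing only positive integers and x^{⊙w} = y^{⊙w} (equal w-th cycle powers), then x = y. In particular, the w-th root of the periodic part of a finite discrete dynamical system is unique if it exists. -/
/-- The number of points of the union of cycles `f` fixed by the `n`-th iterate of the dynamics. -/
noncomputable def fixedCount (n : ℕ) : (ℕ →₀ ℕ) →+ ℕ :=
  Finsupp.liftAddHom fun p => AddMonoidHom.mulLeft (if p ∣ n then p else 0)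

theorem fixedCount_single (n p a : ℕ) :
    fixedCount n (Finsupp.single p a) = (if p ∣ n then p else 0) * a := by
  simp [fixedCount]

theorem fixedCount_apply (n : ℕ) (f : ℕ →₀ ℕ) :
    fixedCount n f = ∑ p ∈ f.support, (if p ∣ n then p else 0) * f p := by
  simp [fixedCount, Finsupp.sum]

theorem fixedCount_cycProd (n : ℕ) (f g : ℕ →₀ ℕ) :
    fixedCount n (cycProd f g) = fixedCount n f * fixedCount n g := by
  simp only [cycProd, map_sum, fixedCount_single]
  rw [fixedCount_apply, fixedCount_apply, Finset.sum_mul_sum]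
  refine Finset.sum_congr rfl fun p _ => Finset.sum_congr rfl fun q _ => ?_
  have hlcm : p.lcm q * (p * q / p.lcm q) = p * q :=
    Nat.mul_div_cancel' (Nat.lcm_dvd_mul p q)
  by_cases hp : p ∣ n <;> by_cases hq : q ∣ n <;> simp only [Nat.lcm_dvd_iff, hp, hq, and_self,
    and_true, and_false, if_true, if_false, zero_mul, mul_zero]
  linear_combination f p * g q * hlcm

theorem fixedCount_cycPow (n : ℕ) (f : ℕ →₀ ℕ) (k : ℕ) :
    fixedCount n (cycPow f k) = fixedCount n f ^ k := by
  induction k with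
  | zero => simp [cycPow, fixedCount_single]
  | succ k ih => rw [cycPow, fixedCount_cycProd, ih, pow_succ']

theorem fixedCount_eq_sum_divisors {n : ℕ} (hn : n ≠ 0) (f : ℕ →₀ ℕ) :
    fixedCount n f = ∑ p ∈ n.divisors, p * f p := by
  rw [fixedCount_apply]
  simp only [ite_mul, zero_mul]
  rw [← Finset.sum_filter]
  refine Finset.sum_subset (fun p hp => ?_) fun p hp hpf => ?_
  · exact Nat.mem_divisors.2 ⟨(Finset.mem_filter.1 hp).2, hn⟩
  · have : f p = 0 := by
      by_contra h
      exact hpf (Finset.mem_filter.2 ⟨Finsupp.mem_support_iff.2 h, Nat.dvd_of_mem_divisors hp⟩)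
    rw [this, mul_zero]

/-- A union of cycles is determined, away from `0`, by its numbers of fixed points. -/
theorem apply_eq_of_fixedCount_eq {f g : ℕ →₀ ℕ} (h : ∀ n, fixedCount n f = fixedCount n g)
    {n : ℕ} (hn : n ≠ 0) : f n = g n := by
  induction n using Nat.strong_induction_on with
  | _ n ih =>
    have key := h n
    rw [fixedCount_eq_sum_divisors hn, fixedCount_eq_sum_divisors hn,
      ← Nat.insert_self_properDivisors hn, Finset.sum_insert Nat.self_notMem_properDivisors,
      Finset.sum_insert Nat.self_notMem_properDivisors] at key
    have hlt : ∑ p ∈ n.properDivisors, p * f p = ∑ p ∈ n.properDivisors, p * g p :=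
      Finset.sum_congr rfl fun p hp => by
        rw [ih p (Nat.mem_properDivisors.1 hp).2 (Nat.pos_of_mem_properDivisors hp).ne']
    rw [hlt] at key
    exact Nat.eq_of_mul_eq_mul_left (Nat.pos_of_ne_zero hn) (Nat.add_right_cancel key)

theorem stmt_17 (w : ℕ) (hw : 2 ≤ w) (x y : ℕ →₀ ℕ)
    (hx : ∀ p ∈ x.support, 0 < p) (hy : ∀ p ∈ y.support, 0 < p)
    (heq : cycPow x w = cycPow y w) :
    x = y := by
  have hfix (n : ℕ) : fixedCount n x = fixedCount n y := by
    have h := congrArg (fixedCount n) heq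
    rw [fixedCount_cycPow, fixedCount_cycPow] at h
    exact Nat.pow_left_injective (by omega : w ≠ 0) h
  have hzero {f : ℕ →₀ ℕ} (hf : ∀ p ∈ f.support, 0 < p) : f 0 = 0 := by
    by_contra h
    exact lt_irrefl 0 (hf 0 (Finsupp.mem_support_iff.2 h))
  ext n
  rcases eq_or_ne n 0 with rfl | hn
  · rw [hzero hx, hzero hy]
  · exact apply_eq_of_fixedCount_eq hfix hn
end
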